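/- arXiv:2408.03169 — 6 statements merged into one kernel-verified Lean document; each statement's English description precedes it below -/
import Mathlib

section
/- Let X be a topological space. Then (a) the empty set and X are a-open; (b) the intersection of two a-open sets is a-open; (c) the union of any family of a-open sets is a-open. -/
open Set Topology

/-- A set is regular open if it equals the interior of its closure. -/
def RegOpen {X : Type*} [TopologicalSpace X] (U : Set X) : Prop :=
  U = interior (closure U)

/-- The δ-interior of `A`: the union of all regular open sets contained in `A`. -/
def deltaInt {X : Type*} [TopologicalSpace X] (A : Set X) : Set X :=
  ⋃₀ {U : Set X | RegOpen U ∧ U ⊆ A}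

/-- The δ-closure of `A`: the complement of the δ-interior of the complement. -/
def deltaCl {X : Type*} [TopologicalSpace X] (A : Set X) : Set X :=
  (deltaInt Aᶜ)ᶜ

/-- `A` is a-open if `A ⊆ int(cl(δ-int A))`. -/
def AOpen {X : Type*} [TopologicalSpace X] (A : Set X) : Prop :=
  A ⊆ interior (closure (deltaInt A))

/-- `A` is a-closed if its complement is a-open. -/
def AClosed {X : Type*} [TopologicalSpace X] (A : Set X) : Prop :=
  AOpen Aᶜ

/-- `A` is a-locally closed if it is the intersection of an a-open and an a-closed set. -/
def ALocallyClosed {X : Type*} [TopologicalSpace X] (A : Set X) : Prop :=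
  ∃ U V : Set X, AOpen U ∧ AClosed V ∧ A = U ∩ V

/-- `A` is e-open if `A ⊆ cl(δ-int A) ∪ int(δ-cl A)`. -/
def EOpen {X : Type*} [TopologicalSpace X] (A : Set X) : Prop :=
  A ⊆ closure (deltaInt A) ∪ interior (deltaCl A)

/-- `A` is e-closed if its complement is e-open. -/
def EClosed {X : Type*} [TopologicalSpace X] (A : Set X) : Prop :=
  EOpen Aᶜ

/-- `A` is e-locally closed if it is the intersection of an e-open and an e-closed set. -/
def ELocallyClosed {X : Type*} [TopologicalSpace X] (A : Set X) : Prop :=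
  ∃ U V : Set X, EOpen U ∧ EClosed V ∧ A = U ∩ V

/-- The a-closure of `A`: the intersection of all a-closed supersets of `A`. -/
def aCl {X : Type*} [TopologicalSpace X] (A : Set X) : Set X :=
  ⋂₀ {F : Set X | AClosed F ∧ A ⊆ F}

/-- The a-interior of `A`: the union of all a-open subsets of `A`. -/
def aInt {X : Type*} [TopologicalSpace X] (A : Set X) : Set X :=
  ⋃₀ {U : Set X | AOpen U ∧ U ⊆ A}

/-- The e-closure of `A`: the intersection of all e-closed supersets of `A`. -/
def eCl {X : Type*} [TopologicalSpace X] (A : Set X) : Set X :=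
  ⋂₀ {F : Set X | EClosed F ∧ A ⊆ F}

/-- `S` is semi-open if `S ⊆ cl(int S)`. -/
def SemiOpen {X : Type*} [TopologicalSpace X] (S : Set X) : Prop :=
  S ⊆ closure (interior S)

/-- `S` is semi-closed if its complement is semi-open. -/
def SemiClosed {X : Type*} [TopologicalSpace X] (S : Set X) : Prop :=
  SemiOpen Sᶜ

/-- The semi-closure of `U`: the intersection of all semi-closed supersets of `U`. -/
def sCl {X : Type*} [TopologicalSpace X] (U : Set X) : Set X :=
  ⋂₀ {F : Set X | SemiClosed F ∧ U ⊆ F}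

/-- `A` is feebly open if there is an open `U` with `U ⊆ A ⊆ scl(U)`. -/
def FeeblyOpen {X : Type*} [TopologicalSpace X] (A : Set X) : Prop :=
  ∃ U : Set X, IsOpen U ∧ U ⊆ A ∧ A ⊆ sCl U

/-- `A` is feebly closed if its complement is feebly open. -/
def FeeblyClosed {X : Type*} [TopologicalSpace X] (A : Set X) : Prop :=
  FeeblyOpen Aᶜ

/-- `A` is feebly locally closed if it is the intersection of a feebly open and a
feebly closed set. -/
def FeeblyLocallyClosed {X : Type*} [TopologicalSpace X] (A : Set X) : Prop :=
  ∃ U V : Set X, FeeblyOpen U ∧ FeeblyClosed V ∧ A = U ∩ V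

/-- `A` is α-open if `A ⊆ int(cl(int A))`. -/
def AlphaOpen {X : Type*} [TopologicalSpace X] (A : Set X) : Prop :=
  A ⊆ interior (closure (interior A))

/-- `A` is α-closed if its complement is α-open. -/
def AlphaClosed {X : Type*} [TopologicalSpace X] (A : Set X) : Prop :=
  AlphaOpen Aᶜ

/-- `A` is α-locally closed if it is the intersection of an α-open and an α-closed set. -/
def AlphaLocallyClosed {X : Type*} [TopologicalSpace X] (A : Set X) : Prop :=
  ∃ U V : Set X, AlphaOpen U ∧ AlphaClosed V ∧ A = U ∩ V

/-- `X` is submaximal if every dense subset of `X` is open. -/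
def Submaximal (X : Type*) [TopologicalSpace X] : Prop :=
  ∀ A : Set X, closure A = univ → IsOpen A

/-- `X` is a-submaximal if every a-dense subset of `X` is a-open. -/
def ASubmaximal (X : Type*) [TopologicalSpace X] : Prop :=
  ∀ A : Set X, aCl A = univ → AOpen A

/-- `X` is e-submaximal if every e-dense subset of `X` is e-open. -/
def ESubmaximal (X : Type*) [TopologicalSpace X] : Prop :=
  ∀ A : Set X, eCl A = univ → EOpen A

/-- `X` is an e-space if a subset is open precisely when it is e-open. -/
def IsESpace (X : Type*) [TopologicalSpace X] : Prop :=
  ∀ A : Set X, IsOpen A ↔ EOpen A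

theorem RegOpen.isOpen' {X : Type*} [TopologicalSpace X] {U : Set X} (h : RegOpen U) :
    IsOpen U := by
  unfold RegOpen at h
  rw [h]
  exact isOpen_interior

theorem deltaInt_isOpen {X : Type*} [TopologicalSpace X] (A : Set X) : IsOpen (deltaInt A) :=
  isOpen_sUnion fun _ hU => hU.1.isOpen'

theorem deltaInt_mono {X : Type*} [TopologicalSpace X] {A B : Set X} (h : A ⊆ B) :
    deltaInt A ⊆ deltaInt B :=
  sUnion_subset_sUnion fun _ hU => ⟨hU.1, hU.2.trans h⟩

theorem RegOpen.inter {X : Type*} [TopologicalSpace X] {U V : Set X}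
    (hU : RegOpen U) (hV : RegOpen V) : RegOpen (U ∩ V) := by
  apply Subset.antisymm
  · exact interior_maximal subset_closure (hU.isOpen'.inter hV.isOpen')
  · intro x hx
    constructor
    · unfold RegOpen at hU
      rw [hU]
      exact interior_mono (closure_mono inter_subset_left) hx
    · unfold RegOpen at hV
      rw [hV]
      exact interior_mono (closure_mono inter_subset_right) hx

theorem deltaInt_inter_subset {X : Type*} [TopologicalSpace X] (A B : Set X) :
    deltaInt A ∩ deltaInt B ⊆ deltaInt (A ∩ B) := by
  rintro x ⟨⟨U, hU, hxU⟩, ⟨V, hV, hxV⟩⟩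
  exact ⟨U ∩ V, ⟨hU.1.inter hV.1, inter_subset_inter hU.2 hV.2⟩, hxU, hxV⟩

theorem aOpen_empty_univ_inter_sUnion {X : Type*} [TopologicalSpace X] :
    AOpen (∅ : Set X) ∧ AOpen (univ : Set X) ∧
    (∀ A B : Set X, AOpen A → AOpen B → AOpen (A ∩ B)) ∧
    (∀ 𝒜 : Set (Set X), (∀ A ∈ 𝒜, AOpen A) → AOpen (⋃₀ 𝒜)) := by
  refine ⟨empty_subset _, ?_, ?_, ?_⟩
  · have h : deltaInt (univ : Set X) = univ :=
      univ_subset_iff.mp fun x _ => ⟨univ, ⟨by simp [RegOpen], subset_rfl⟩, mem_univ x⟩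
    simp [AOpen, h]
  · intro A B hA hB x hx
    refine interior_mono (closure_mono (deltaInt_inter_subset A B)) ?_
    refine interior_maximal (s := closure (deltaInt A ∩ deltaInt B)) ?_
      (isOpen_interior.inter isOpen_interior) ⟨hA hx.1, hB hx.2⟩
    rintro y ⟨hy1, hy2⟩
    have h1 := isOpen_interior.closure_inter ⟨interior_subset hy1, hy2⟩
    refine closure_minimal ?_ isClosed_closure h1
    rintro z ⟨hz1, hz2⟩
    exact (deltaInt_isOpen A).inter_closure ⟨hz1, interior_subset hz2⟩
  · rintro F hF x ⟨A, hA, hx⟩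
    exact interior_mono (closure_mono (deltaInt_mono (subset_sUnion_of_mem hA))) (hF A hA hx)
end

section
/- Let X be a topological space. Then every a-open subset of X is feebly open, and every a-closed subset of X is feebly closed. -/
open Set Topology

theorem aOpen_feeblyOpen_and_aClosed_feeblyClosed {X : Type*} [TopologicalSpace X] :
    (∀ A : Set X, AOpen A → FeeblyOpen A) ∧
    (∀ A : Set X, AClosed A → FeeblyClosed A) := by
  have key : ∀ A : Set X, AOpen A → FeeblyOpen A := by
    intro A hA
    refine ⟨deltaInt A, ?_, ?_, ?_⟩
    · refine isOpen_sUnion ?_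
      rintro U ⟨hU, -⟩
      have h : U = interior (closure U) := hU
      rw [h]
      exact isOpen_interior
    · exact sUnion_subset fun U hU => hU.2
    · rintro x hx F ⟨hF, hUF⟩
      by_contra hxF
      have h1 : x ∈ closure (interior Fᶜ) := hF hxF
      have h2 : x ∈ interior (closure F) := interior_mono (closure_mono hUF) (hA hx)
      obtain ⟨y, hy1, hy2⟩ := mem_closure_iff.1 h1 _ isOpen_interior h2
      rw [interior_compl] at hy2
      exact hy2 (interior_subset hy1)
  exact ⟨key, fun A hA => key Aᶜ hA⟩
end

section
/- Let X be a topological space. Then every a-locally closed subset of X is feebly locally closed. -/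
open Set Topology

theorem feeblyOpen_of_aOpen {X : Type*} [TopologicalSpace X] {A : Set X}
    (hA : AOpen A) : FeeblyOpen A := by
  refine ⟨deltaInt A, ?_, ?_, ?_⟩
  · apply isOpen_sUnion
    rintro U ⟨hU, -⟩
    have hU' : U = interior (closure U) := hU
    rw [hU']
    exact isOpen_interior
  · exact sUnion_subset fun U hU => hU.2
  · intro x hx F hF
    obtain ⟨hF, hUF⟩ := hF
    by_contra hxF
    obtain ⟨y, hy1, hy2⟩ := mem_closure_iff.1 (hF hxF) _ isOpen_interior (hA hx)
    obtain ⟨z, hz1, hz2⟩ := mem_closure_iff.1 (interior_subset hy1) _ isOpen_interior hy2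
    exact interior_subset hz1 (hUF hz2)

theorem aLocallyClosed_subset_feeblyLocallyClosed {X : Type*} [TopologicalSpace X]
    (A : Set X) (hA : ALocallyClosed A) : FeeblyLocallyClosed A := by
  obtain ⟨U, V, hU, hV, h⟩ := hA
  exact ⟨U, V, feeblyOpen_of_aOpen hU, feeblyOpen_of_aOpen hV, h⟩
end

section
/- Let X be a topological space and let A and B be subsets of X. If A is a-closed and B is e-closed, then A ∩ B is e-closed. -/
open Set Topology

theorem aClosed_inter_eClosed {X : Type*} [TopologicalSpace X] (A B : Set X)
    (hA : AClosed A) (hB : EClosed B) : EClosed (A ∩ B) := by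
  have hmono : ∀ S T : Set X, S ⊆ T → deltaInt S ⊆ deltaInt T := by
    intro S T h
    exact sUnion_subset_sUnion (fun U hU => ⟨hU.1, hU.2.trans h⟩)
  have hcl : ∀ S T : Set X, S ⊆ T → deltaCl S ⊆ deltaCl T := by
    intro S T h
    exact compl_subset_compl.2 (hmono _ _ (compl_subset_compl.2 h))
  have h1 : Aᶜ ⊆ (A ∩ B)ᶜ := compl_subset_compl.2 inter_subset_left
  have h2 : Bᶜ ⊆ (A ∩ B)ᶜ := compl_subset_compl.2 inter_subset_right
  intro x hx
  by_cases hxA : x ∈ A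
  · have hxB : x ∈ Bᶜ := fun hb => hx ⟨hxA, hb⟩
    rcases hB hxB with h | h
    · exact Or.inl (closure_mono (hmono _ _ h2) h)
    · exact Or.inr (interior_mono (hcl _ _ h2) h)
  · exact Or.inl (closure_mono (hmono _ _ h1) (interior_subset (hA hxA)))
end

section
/- Let X be a topological space and A a subset of X. Then A is a-locally closed if and only if a-cl(A) \ A is a-closed. -/
open Set Topology

theorem AOpen.sUnion' {X : Type*} [TopologicalSpace X] {S : Set (Set X)}
    (h : ∀ U ∈ S, AOpen U) : AOpen (⋃₀ S) := by
  rintro x ⟨U, hU, hx⟩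
  exact interior_mono (closure_mono (deltaInt_mono (subset_sUnion_of_mem hU))) (h U hU hx)

theorem AOpen.union' {X : Type*} [TopologicalSpace X] {U V : Set X} (hU : AOpen U)
    (hV : AOpen V) : AOpen (U ∪ V) := by
  rw [← sUnion_pair]
  apply AOpen.sUnion'
  rintro W (rfl | rfl) <;> assumption

theorem aCl_aClosed {X : Type*} [TopologicalSpace X] (A : Set X) : AClosed (aCl A) := by
  unfold AClosed aCl
  rw [compl_sInter]
  apply AOpen.sUnion'
  rintro _ ⟨F, hF, rfl⟩
  exact hF.1

theorem subset_aCl {X : Type*} [TopologicalSpace X] (A : Set X) : A ⊆ aCl A :=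
  subset_sInter fun _ h => h.2

theorem aLocallyClosed_iff_aCl_diff_aClosed {X : Type*} [TopologicalSpace X] (A : Set X) :
    ALocallyClosed A ↔ AClosed (aCl A \ A) := by
  constructor
  · rintro ⟨U, V, hU, hV, hA⟩
    have hcV : aCl A ⊆ V := sInter_subset_of_mem ⟨hV, by rw [hA]; exact inter_subset_right⟩
    have he : (aCl A \ A)ᶜ = (aCl A)ᶜ ∪ U := by
      ext x
      have h1 := @hcV x
      have h2 : x ∈ A ↔ x ∈ U ∧ x ∈ V := by
        conv_lhs => rw [hA]
        rfl
      simp only [mem_compl_iff, mem_diff, mem_union]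
      tauto
    unfold AClosed
    rw [he]
    exact AOpen.union' (aCl_aClosed A) hU
  · intro h
    refine ⟨(aCl A \ A)ᶜ, aCl A, h, aCl_aClosed A, ?_⟩
    ext x
    have h1 := @subset_aCl X _ A x
    simp only [mem_compl_iff, mem_diff, mem_inter_iff]
    tauto
end

section
/- Let X be a regular topological space which is an e-space (a subset of X is open if and only if it is e-open). Then the following are equivalent: (a) X is submaximal; (b) X is a-submaximal; (c) X is e-submaximal. -/
open Set Topology

theorem aOpen_of_isOpen_aux {X : Type*} [TopologicalSpace X] [RegularSpace X]
    {A : Set X} (hA : IsOpen A) : AOpen A := by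
  have key : A ⊆ deltaInt A := by
    intro x hx
    obtain ⟨F, hF, hFc, hFA⟩ := exists_mem_nhds_isClosed_subset (hA.mem_nhds hx)
    refine ⟨interior F, ⟨?_, interior_subset.trans hFA⟩, mem_interior_iff_mem_nhds.2 hF⟩
    refine Subset.antisymm (interior_maximal subset_closure isOpen_interior) ?_
    exact interior_mono (closure_minimal interior_subset hFc)
  exact interior_maximal (key.trans subset_closure) hA

theorem submaximal_aSubmaximal_eSubmaximal_equiv (X : Type*) [TopologicalSpace X]
    [RegularSpace X] (hX : IsESpace X) :
    (Submaximal X ↔ ASubmaximal X) ∧ (ASubmaximal X ↔ ESubmaximal X) := by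
  have hA : ∀ A : Set X, AOpen A ↔ IsOpen A := fun A =>
    ⟨fun h => (hX A).2 (h.trans (interior_subset.trans subset_union_left)),
      aOpen_of_isOpen_aux⟩
  have hE : ∀ A : Set X, EOpen A ↔ IsOpen A := fun A => (hX A).symm
  have ha : ∀ A : Set X, aCl A = closure A := fun A => by
    simp only [aCl, AClosed, hA, isOpen_compl_iff, closure]
  have he : ∀ A : Set X, eCl A = closure A := fun A => by
    simp only [eCl, EClosed, hE, isOpen_compl_iff, closure]
  simp only [Submaximal, ASubmaximal, ESubmaximal, ha, he, hA, hE, and_self]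
end
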